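/- Let s, t be real numbers with |t − s| < 1, and let α = min{s, t}. Then the function Θ_{s,t}(x) = [ψ(x+t) − ψ(x+s)]² + (t − s)[ψ'(x+t) − ψ'(x+s)] is completely monotonic on the interval (−α, ∞). -/

import Mathlib

/-- The digamma function `ψ = Γ'/Γ`, as the derivative of `log ∘ Γ`. -/
noncomputable def digamma (x : ℝ) : ℝ := deriv (fun y : ℝ => Real.log (Real.Gamma y)) x

/-- The trigamma function `ψ'`. -/
noncomputable def trigamma (x : ℝ) : ℝ := deriv digamma x

/-- `(-1)^n` times the `n`-th derivative of `F`. -/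
noncomputable def signedDeriv (n : ℕ) (F : ℝ → ℝ) (x : ℝ) : ℝ := (-1 : ℝ) ^ n * iteratedDeriv n F x

/-- Analytic and completely monotonic on `(0, ∞)`. -/
structure IsCompletelyMonotonePos (F : ℝ → ℝ) : Prop where
  analyticAt : ∀ x > 0, AnalyticAt ℝ F x
  nonneg : ∀ n, ∀ x > 0, 0 ≤ signedDeriv n F x

theorem signedDeriv_zero (F : ℝ → ℝ) : signedDeriv 0 F = F := by
  ext x; simp [signedDeriv]

theorem deriv_signedDeriv (n : ℕ) (F : ℝ → ℝ) (x : ℝ) :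
    deriv (signedDeriv n F) x = -signedDeriv (n + 1) F x := by
  unfold signedDeriv
  rw [deriv_const_mul_field, iteratedDeriv_succ]
  ring

theorem AnalyticAt.signedDeriv {F : ℝ → ℝ} {x : ℝ} (hF : AnalyticAt ℝ F x) (n : ℕ) :
    AnalyticAt ℝ (signedDeriv n F) x := by
  have h : AnalyticAt ℝ (iteratedDeriv n F) x := by
    rw [iteratedDeriv_eq_iterate]
    exact hF.iterated_deriv n
  exact analyticAt_const.mul h

theorem AnalyticAt.comp_add_right {F : ℝ → ℝ} {x a : ℝ} (hF : AnalyticAt ℝ F (x + a)) :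
    AnalyticAt ℝ (fun y => F (y + a)) x :=
  hF.comp (f := fun y => y + a) (analyticAt_id.add analyticAt_const)

theorem signedDeriv_comp_add_const (n : ℕ) (F : ℝ → ℝ) (a x : ℝ) :
    signedDeriv n (fun y => F (y + a)) x = signedDeriv n F (x + a) := by
  simp only [signedDeriv, iteratedDeriv_comp_add_const]

theorem signedDeriv_sub (n : ℕ) {F G : ℝ → ℝ} {x : ℝ} (hF : AnalyticAt ℝ F x)
    (hG : AnalyticAt ℝ G x) :
    signedDeriv n (fun y => F y - G y) x = signedDeriv n F x - signedDeriv n G x := by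
  unfold signedDeriv
  rw [iteratedDeriv_fun_sub hF.contDiffAt hG.contDiffAt]
  ring

namespace IsCompletelyMonotonePos

variable {F G : ℝ → ℝ}

theorem congr (hF : IsCompletelyMonotonePos F) (h : ∀ x > 0, F x = G x) :
    IsCompletelyMonotonePos G := by
  have he : ∀ x > 0, F =ᶠ[nhds x] G := fun x hx => by
    filter_upwards [Ioi_mem_nhds hx] with y hy using h y hy
  refine ⟨fun x hx => (hF.analyticAt x hx).congr (he x hx), fun n x hx => ?_⟩
  rw [signedDeriv, ← (he x hx).iteratedDeriv_eq n]
  exact hF.nonneg n x hx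

theorem add (hF : IsCompletelyMonotonePos F) (hG : IsCompletelyMonotonePos G) :
    IsCompletelyMonotonePos (fun x => F x + G x) := by
  refine ⟨fun x hx => (hF.analyticAt x hx).add (hG.analyticAt x hx), fun n x hx => ?_⟩
  rw [signedDeriv, iteratedDeriv_fun_add (hF.analyticAt x hx).contDiffAt
    (hG.analyticAt x hx).contDiffAt, mul_add]
  exact add_nonneg (hF.nonneg n x hx) (hG.nonneg n x hx)

theorem mul (hF : IsCompletelyMonotonePos F) (hG : IsCompletelyMonotonePos G) :
    IsCompletelyMonotonePos (fun x => F x * G x) := by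
  refine ⟨fun x hx => (hF.analyticAt x hx).mul (hG.analyticAt x hx), fun n x hx => ?_⟩
  rw [signedDeriv, iteratedDeriv_fun_mul (hF.analyticAt x hx).contDiffAt
    (hG.analyticAt x hx).contDiffAt, Finset.mul_sum]
  refine Finset.sum_nonneg fun i hi => ?_
  have hi' : i + (n - i) = n := by have := Finset.mem_range.1 hi; omega
  have h := mul_nonneg (mul_nonneg (Nat.cast_nonneg (α := ℝ) (n.choose i)) (hF.nonneg i x hx))
    (hG.nonneg (n - i) x hx)
  convert h using 1
  nth_rewrite 1 [← hi']
  simp only [signedDeriv, pow_add]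
  ring

theorem const {c : ℝ} (hc : 0 ≤ c) : IsCompletelyMonotonePos (fun _ => c) := by
  refine ⟨fun x _ => analyticAt_const, fun n x _ => ?_⟩
  cases n with
  | zero => simpa [signedDeriv] using hc
  | succ n => simp [signedDeriv, iteratedDeriv_const]

theorem comp_add_const (hF : IsCompletelyMonotonePos F) {a : ℝ} (ha : 0 ≤ a) :
    IsCompletelyMonotonePos (fun x => F (x + a)) := by
  refine ⟨fun x hx => (hF.analyticAt _ (by linarith)).comp_add_right, fun n x hx => ?_⟩
  rw [signedDeriv_comp_add_const]
  exact hF.nonneg n _ (by linarith)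

theorem inv : IsCompletelyMonotonePos (fun x => x⁻¹) := by
  refine ⟨fun x hx => analyticAt_id.inv hx.ne', fun n x hx => ?_⟩
  rw [signedDeriv, iteratedDeriv_eq_iterate, iter_deriv_inv]
  have h : (-1 : ℝ) ^ n * (-1) ^ n = 1 := by rw [← mul_pow]; norm_num
  rw [← mul_assoc, ← mul_assoc, h]
  positivity

theorem inv_add {a : ℝ} (ha : 0 ≤ a) : IsCompletelyMonotonePos (fun x => (x + a)⁻¹) :=
  inv.comp_add_const ha

theorem convexOn (hF : IsCompletelyMonotonePos F) (n : ℕ) :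
    ConvexOn ℝ (Set.Ioi 0) (signedDeriv n F) := by
  have hd : deriv (signedDeriv n F) = fun x => -signedDeriv (n + 1) F x :=
    funext (deriv_signedDeriv n F)
  refine convexOn_of_deriv2_nonneg' (convex_Ioi 0) ?_ ?_ ?_
  · exact fun x hx => ((hF.analyticAt x hx).signedDeriv n).differentiableAt.differentiableWithinAt
  · rw [hd]
    exact fun x hx =>
      ((hF.analyticAt x hx).signedDeriv (n + 1)).neg.differentiableAt.differentiableWithinAt
  · intro x hx
    simp only [Function.iterate_succ, Function.iterate_zero, Function.comp_apply, id]
    rw [hd, deriv.fun_neg, deriv_signedDeriv, neg_neg]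
    exact hF.nonneg _ x hx

theorem sub_comp_add_natCast
    (hD : IsCompletelyMonotonePos (fun x => F x - F (x + 1))) (k : ℕ) :
    IsCompletelyMonotonePos (fun x => F x - F (x + k)) := by
  induction k with
  | zero => exact (const le_rfl).congr (by simp)
  | succ k ih =>
    refine (ih.add (hD.comp_add_const k.cast_nonneg)).congr fun x _ => ?_
    push_cast
    rw [← add_assoc]
    ring

/-- If `F` tends to `0` along `x + ℕ` and `F x - F (x + 1)` is completely monotonic, then so is `F`,
and all its derivatives tend to `0` along `x + ℕ`. -/
theorem of_sub_comp_add_one (hF : ∀ x > 0, AnalyticAt ℝ F x)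
    (hD : IsCompletelyMonotonePos (fun x => F x - F (x + 1)))
    (h0 : ∀ x > 0, Filter.Tendsto (fun k : ℕ => F (x + k)) Filter.atTop (nhds 0)) :
    IsCompletelyMonotonePos F ∧ ∀ n, ∀ x > 0,
      Filter.Tendsto (fun k : ℕ => signedDeriv n F (x + k)) Filter.atTop (nhds 0) := by
  have hP := sub_comp_add_natCast hD
  have hPn : ∀ n k : ℕ, ∀ x > 0, signedDeriv n (fun x => F x - F (x + k)) x =
      signedDeriv n F x - signedDeriv n F (x + k) := fun n k x hx => by
    have hxk : (0 : ℝ) < x + k := by positivity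
    rw [signedDeriv_sub n (hF x hx) (hF _ hxk).comp_add_right, signedDeriv_comp_add_const]
  have hlim : ∀ n, (∀ x > 0, Filter.Tendsto (fun k : ℕ => signedDeriv n F (x + k))
      Filter.atTop (nhds 0)) → ∀ x > 0, Filter.Tendsto
      (fun k : ℕ => signedDeriv n (fun x => F x - F (x + k)) x) Filter.atTop
      (nhds (signedDeriv n F x)) := fun n h x hx => by
    simp only [hPn n _ x hx]
    simpa using (tendsto_const_nhds (x := signedDeriv n F x)).sub (h x hx)
  have hnn : ∀ n, (∀ x > 0, Filter.Tendsto (fun k : ℕ => signedDeriv n F (x + k))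
      Filter.atTop (nhds 0)) → ∀ x > 0, 0 ≤ signedDeriv n F x := fun n h x hx =>
    ge_of_tendsto' (hlim n h x hx) fun k => (hP k).nonneg n x hx
  have key : ∀ n, ∀ x > 0,
      Filter.Tendsto (fun k : ℕ => signedDeriv n F (x + k)) Filter.atTop (nhds 0) := by
    intro n
    induction n with
    | zero => simpa only [signedDeriv_zero] using h0
    | succ n ih =>
      have hconv : ConvexOn ℝ (Set.Ioi 0) (signedDeriv n F) := by
        refine ⟨convex_Ioi 0, fun x hx y hy a b ha hb hab => ?_⟩
        have hz := convex_Ioi (0 : ℝ) hx hy ha hb hab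
        refine le_of_tendsto_of_tendsto' (hlim n ih _ hz)
          (((hlim n ih x hx).const_smul a).add ((hlim n ih y hy).const_smul b)) fun k => ?_
        exact ((hP k).convexOn n).2 hx hy ha hb hab
      have hsucc : ∀ x > 0, 0 ≤ signedDeriv (n + 1) F x := by
        intro x hx
        have hmono : AntitoneOn (signedDeriv n F) (Set.Ioi 0) := by
          intro u hu v hv huv
          refine le_of_tendsto_of_tendsto' (hlim n ih v hv) (hlim n ih u hu) fun k => ?_
          refine antitoneOn_of_deriv_nonpos (convex_Ioi 0) ?_ ?_ ?_ hu hv huv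
          · exact ((hP k).convexOn n).continuousOn isOpen_Ioi
          · rw [interior_Ioi]
            exact fun w hw => (((hP k).analyticAt w hw).signedDeriv n).differentiableAt
              |>.differentiableWithinAt
          · rw [interior_Ioi]
            intro w hw
            rw [deriv_signedDeriv]
            exact neg_nonpos.2 ((hP k).nonneg _ w hw)
        have hd : deriv (signedDeriv n F) x ≤ 0 := by
          rw [← derivWithin_of_isOpen isOpen_Ioi hx]
          exact hmono.derivWithin_nonpos
        rw [deriv_signedDeriv] at hd
        linarith
      have hslope : ∀ x > 0, signedDeriv (n + 1) F (x + 1) ≤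
          signedDeriv n F x - signedDeriv n F (x + 1) := by
        intro x hx
        have hx1 : x + 1 ∈ Set.Ioi (0 : ℝ) := by simp only [Set.mem_Ioi]; linarith
        have h := hconv.slope_le_deriv hx hx1 (by linarith)
          ((hF _ hx1).signedDeriv n).differentiableAt
        rw [deriv_signedDeriv, slope_def_field] at h
        norm_num at h
        linarith
      intro x hx
      rw [← Filter.tendsto_add_atTop_iff_nat 1]
      have h1 := ih x hx
      have h2 := (h1.sub ((Filter.tendsto_add_atTop_iff_nat 1).2 h1))
      rw [sub_zero] at h2
      refine squeeze_zero (fun k => hsucc _ (by positivity)) (fun k => ?_) h2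
      have := hslope (x + k) (by positivity)
      push_cast
      rwa [← add_assoc]
  exact ⟨⟨hF, fun n => hnn n (key n)⟩, key⟩

end IsCompletelyMonotonePos

theorem Real.analyticAt_Gamma {x : ℝ} (hx : 0 < x) : AnalyticAt ℝ Real.Gamma x := by
  have h : AnalyticAt ℂ Complex.Gamma (x : ℂ) := by
    rw [Complex.analyticAt_iff_eventually_differentiableAt]
    have ho : IsOpen {z : ℂ | 0 < z.re} := isOpen_lt continuous_const Complex.continuous_re
    filter_upwards [ho.mem_nhds (show (x : ℂ) ∈ {z : ℂ | 0 < z.re} by simpa using hx)] with z hz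
    refine Complex.differentiableAt_Gamma z fun m hm => ?_
    have hz' : 0 < z.re := hz
    rw [hm] at hz'
    simp only [Complex.neg_re, Complex.natCast_re] at hz'
    linarith [(Nat.cast_nonneg m : (0 : ℝ) ≤ m)]
  exact h.re_ofReal.congr (Filter.Eventually.of_forall fun y => by
    simp [Complex.Gamma_ofReal])

theorem analyticAt_log_Gamma {x : ℝ} (hx : 0 < x) :
    AnalyticAt ℝ (fun y => Real.log (Real.Gamma y)) x :=
  (Real.analyticAt_Gamma hx).log (Real.Gamma_pos_of_pos hx)

theorem analyticAt_digamma {x : ℝ} (hx : 0 < x) : AnalyticAt ℝ digamma x :=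
  (analyticAt_log_Gamma hx).deriv

theorem digamma_add_one {x : ℝ} (hx : 0 < x) : digamma (x + 1) = digamma x + x⁻¹ := by
  have he : (fun y => Real.log (Real.Gamma (y + 1))) =ᶠ[nhds x]
      fun y => Real.log (Real.Gamma y) + Real.log y := by
    filter_upwards [Ioi_mem_nhds hx] with y hy
    have hy' : 0 < y := hy
    rw [Real.Gamma_add_one hy'.ne', Real.log_mul hy'.ne' (Real.Gamma_pos_of_pos hy').ne', add_comm]
  have h := he.deriv_eq
  rw [deriv_comp_add_const (f := fun y => Real.log (Real.Gamma y)),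
    deriv_fun_add (analyticAt_log_Gamma hx).differentiableAt (Real.differentiableAt_log hx.ne'),
    Real.deriv_log] at h
  exact h

theorem monotoneOn_digamma : MonotoneOn digamma (Set.Ioi 0) :=
  Real.convexOn_log_Gamma.monotoneOn_deriv fun _ hx => (analyticAt_log_Gamma hx).differentiableAt

theorem tendsto_inv_add_natCast (a : ℝ) :
    Filter.Tendsto (fun k : ℕ => (a + k)⁻¹) Filter.atTop (nhds 0) :=
  tendsto_inv_atTop_zero.comp
    (Filter.tendsto_atTop_add_const_left _ a tendsto_natCast_atTop_atTop)

section digammaDiff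

variable {d : ℝ}

/-- The difference `ψ(x + d) - ψ(x)`. -/
noncomputable def digammaDiff (d x : ℝ) : ℝ := digamma (x + d) - digamma x

theorem analyticAt_digammaDiff (hd : 0 ≤ d) {x : ℝ} (hx : 0 < x) :
    AnalyticAt ℝ (digammaDiff d) x :=
  (analyticAt_digamma (by linarith)).comp_add_right.sub (analyticAt_digamma hx)

theorem digammaDiff_sub_digammaDiff_add_one (hd : 0 ≤ d) {x : ℝ} (hx : 0 < x) :
    digammaDiff d x - digammaDiff d (x + 1) = x⁻¹ - (x + d)⁻¹ := by
  unfold digammaDiff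
  rw [add_right_comm, digamma_add_one hx, digamma_add_one (by linarith : 0 < x + d)]
  ring

theorem tendsto_digammaDiff (hd : 0 ≤ d) (hd1 : d ≤ 1) {x : ℝ} (hx : 0 < x) :
    Filter.Tendsto (fun k : ℕ => digammaDiff d (x + k)) Filter.atTop (nhds 0) := by
  refine squeeze_zero (fun k => ?_) (fun k => ?_) (tendsto_inv_add_natCast x)
  all_goals
    have hk : 0 < x + k := by positivity
  · exact sub_nonneg.2 (monotoneOn_digamma hk (by simp only [Set.mem_Ioi]; linarith) (by linarith))
  · have h := monotoneOn_digamma (a := x + k + d) (b := x + k + 1)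
      (by simp only [Set.mem_Ioi]; linarith) (by simp only [Set.mem_Ioi]; linarith) (by linarith)
    rw [digamma_add_one hk] at h
    unfold digammaDiff
    linarith

theorem isCompletelyMonotonePos_inv_sub_inv (hd : 0 ≤ d) :
    IsCompletelyMonotonePos (fun x => x⁻¹ - (x + d)⁻¹) := by
  refine (((IsCompletelyMonotonePos.const hd).mul .inv).mul (.inv_add hd)).congr fun x hx => ?_
  have : 0 < x + d := by linarith
  field_simp
  ring

theorem tendsto_deriv_digammaDiff (hd : 0 ≤ d) (hd1 : d ≤ 1) {x : ℝ} (hx : 0 < x) :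
    Filter.Tendsto (fun k : ℕ => deriv (digammaDiff d) (x + k)) Filter.atTop (nhds 0) := by
  have h := (IsCompletelyMonotonePos.of_sub_comp_add_one
    (fun x hx => analyticAt_digammaDiff hd hx)
    ((isCompletelyMonotonePos_inv_sub_inv hd).congr fun x hx =>
      (digammaDiff_sub_digammaDiff_add_one hd hx).symm)
    (fun x hx => tendsto_digammaDiff hd hd1 hx)).2 1 x hx
  simpa [signedDeriv] using h.neg

theorem deriv_digammaDiff_sub (hd : 0 ≤ d) {x : ℝ} (hx : 0 < x) :
    deriv (digammaDiff d) x - deriv (digammaDiff d) (x + 1) =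
      -(x ^ 2)⁻¹ + ((x + d) ^ 2)⁻¹ := by
  have he : (fun y => digammaDiff d y - digammaDiff d (y + 1)) =ᶠ[nhds x]
      fun y => y⁻¹ - (y + d)⁻¹ := by
    filter_upwards [Ioi_mem_nhds hx] with y hy using digammaDiff_sub_digammaDiff_add_one hd hy
  have hxd : x + d ≠ 0 := by linarith
  have h := he.deriv_eq
  have h1 : HasDerivAt (fun y : ℝ => y⁻¹ - (y + d)⁻¹) (-(x ^ 2)⁻¹ - -((x + d) ^ 2)⁻¹) x :=
    (hasDerivAt_inv hx.ne').sub ((hasDerivAt_inv hxd).comp_add_const x d)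
  rw [h1.deriv, deriv_fun_sub (analyticAt_digammaDiff hd hx).differentiableAt
    (analyticAt_digammaDiff hd (by linarith : 0 < x + 1)).comp_add_right.differentiableAt,
    deriv_comp_add_const] at h
  rw [h]
  ring

/-- The cofactor of `x⁻¹ - (x + d)⁻¹` in the unit difference of
`digammaDiff d ^ 2 + d * deriv (digammaDiff d)`. -/
theorem isCompletelyMonotonePos_cofactor (hd : 0 ≤ d) (hd1 : d ≤ 1) :
    IsCompletelyMonotonePos
      (fun x => 2 * digammaDiff d x - (1 + d) * x⁻¹ + (1 - d) * (x + d)⁻¹) := by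
  refine (IsCompletelyMonotonePos.of_sub_comp_add_one (fun x hx => ?_) ?_ fun x hx => ?_).1
  · have h2 : AnalyticAt ℝ (fun x : ℝ => (x + d)⁻¹) x :=
      (IsCompletelyMonotonePos.inv_add hd).analyticAt x hx
    exact ((analyticAt_const.mul (analyticAt_digammaDiff hd hx)).sub
      (analyticAt_const.mul (analyticAt_id.inv hx.ne'))).add (analyticAt_const.mul h2)
  · have hc : 0 ≤ (1 - d ^ 2) * d := mul_nonneg (by nlinarith) hd
    refine (((((IsCompletelyMonotonePos.const hc).mul .inv).mul (.inv_add hd)).mul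
      (.inv_add zero_le_one)).mul (.inv_add (by linarith : 0 ≤ 1 + d))).congr fun x hx => ?_
    have h := digammaDiff_sub_digammaDiff_add_one hd hx
    have e : digammaDiff d (x + 1) = digammaDiff d x - (x⁻¹ - (x + d)⁻¹) := by linarith
    rw [e]
    have h1 : 0 < x + d := by linarith
    have h2 : 0 < x + 1 := by linarith
    have h3 : 0 < x + (1 + d) := by linarith
    rw [add_assoc x 1 d]
    field_simp
    ring
  · have h := (((tendsto_digammaDiff hd hd1 hx).const_mul 2).sub
      ((tendsto_inv_add_natCast x).const_mul (1 + d))).add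
      ((tendsto_inv_add_natCast (x + d)).const_mul (1 - d))
    simp only [mul_zero, sub_zero, add_zero] at h
    simpa only [add_right_comm x _ d] using h

theorem isCompletelyMonotonePos_digammaDiff_sq_add (hd : 0 ≤ d) (hd1 : d ≤ 1) :
    IsCompletelyMonotonePos (fun x => digammaDiff d x ^ 2 + d * deriv (digammaDiff d) x) := by
  refine (IsCompletelyMonotonePos.of_sub_comp_add_one (fun x hx => ?_) ?_ fun x hx => ?_).1
  · have h := analyticAt_digammaDiff hd hx
    exact (h.pow 2).add (analyticAt_const.mul h.deriv)
  · refine ((isCompletelyMonotonePos_inv_sub_inv hd).mul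
      (isCompletelyMonotonePos_cofactor hd hd1)).congr fun x hx => ?_
    have h := digammaDiff_sub_digammaDiff_add_one hd hx
    have e : digammaDiff d (x + 1) = digammaDiff d x - (x⁻¹ - (x + d)⁻¹) := by linarith
    have h' := deriv_digammaDiff_sub hd hx
    have e' : deriv (digammaDiff d) (x + 1) =
      deriv (digammaDiff d) x - (-(x ^ 2)⁻¹ + ((x + d) ^ 2)⁻¹) := by linarith
    rw [e, e']
    have h1 : 0 < x + d := by linarith
    field_simp
    ring
  · simpa using ((tendsto_digammaDiff hd hd1 hx).pow 2).add
      ((tendsto_deriv_digammaDiff hd hd1 hx).const_mul d)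

theorem deriv_digammaDiff (hd : 0 ≤ d) {x : ℝ} (hx : 0 < x) :
    deriv (digammaDiff d) x = trigamma (x + d) - trigamma x := by
  have hxd : 0 < x + d := by linarith
  unfold digammaDiff
  rw [deriv_fun_sub (analyticAt_digamma hxd).comp_add_right.differentiableAt
    (analyticAt_digamma hx).differentiableAt, deriv_comp_add_const]
  rfl

end digammaDiff

theorem signedDeriv_theta_nonneg {s t : ℝ} (hst : s ≤ t) (h : t - s ≤ 1) (n : ℕ) {x : ℝ}
    (hx : -s < x) :
    0 ≤ signedDeriv n (fun y : ℝ => (digamma (y + t) - digamma (y + s)) ^ 2 +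
      (t - s) * (trigamma (y + t) - trigamma (y + s))) x := by
  have hd : 0 ≤ t - s := sub_nonneg.2 hst
  have hcm : IsCompletelyMonotonePos (fun u => (digamma (u + (t - s)) - digamma u) ^ 2 +
      (t - s) * (trigamma (u + (t - s)) - trigamma u)) :=
    (isCompletelyMonotonePos_digammaDiff_sq_add hd h).congr fun u hu => by
      rw [deriv_digammaDiff hd hu, digammaDiff]
  have hnn := hcm.nonneg n (x + s) (by linarith)
  rw [← signedDeriv_comp_add_const] at hnn
  simpa only [add_assoc, add_sub_cancel] using hnn

/-- For `|t - s| < 1`, the function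
`Θ_{s,t}(x) = [ψ(x+t) − ψ(x+s)]² + (t − s)[ψ'(x+t) − ψ'(x+s)]`
is completely monotonic on `(−min{s,t}, ∞)`. -/
theorem theta_completely_monotonic (s t : ℝ) (h : |t - s| < 1) :
    ∀ n : ℕ, ∀ x ∈ Set.Ioi (-(min s t)),
      0 ≤ (-1 : ℝ) ^ n *
        iteratedDeriv n
          (fun y : ℝ =>
            (digamma (y + t) - digamma (y + s)) ^ 2 +
              (t - s) * (trigamma (y + t) - trigamma (y + s))) x := by
  intro n x hx
  rw [Set.mem_Ioi] at hx
  obtain ⟨h1, h2⟩ := abs_lt.1 h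
  rcases le_total s t with hst | hst
  · rw [min_eq_left hst] at hx
    exact signedDeriv_theta_nonneg hst h2.le n hx
  · rw [min_eq_right hst] at hx
    have hnn := signedDeriv_theta_nonneg hst (by linarith) n hx
    rw [signedDeriv] at hnn
    convert hnn using 3
    funext y
    ring
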